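/- arXiv:1911.02555 — 3 statements merged into one kernel-verified Lean document; each statement's English description precedes it below -/
import Mathlib

section
/- The symplectic group Sp(4, 𝔽₂), i.e., the group of 4×4 matrices M over the field ZMod 2 satisfying M * J * Mᵀ = J where J is the standard symplectic structure matrix (Matrix.symplecticGroup (Fin 2) (ZMod 2)), has exactly 720 elements and is isomorphic as a group to the symmetric group Equiv.Perm (Fin 6). -/
namespace SymplecticFour

open Matrix

/-- The columns are even-size subsets of a six-element set, whose intersection numbers modulo `2`
are the entries of the standard symplectic form. -/
def evenBasis : Matrix (Fin 6) (Fin 2 ⊕ Fin 2) (ZMod 2) :=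
  (!![1, 0, 0, 0; 1, 0, 1, 0; 0, 0, 1, 0; 0, 1, 0, 0; 0, 1, 0, 1; 0, 0, 0, 1] :
    Matrix (Fin 6) (Fin 4) (ZMod 2)).submatrix id finSumFinEquiv

def ones : Matrix (Fin 6) Unit (ZMod 2) := fun _ _ => 1

def firstHalf : Matrix (Fin 6) Unit (ZMod 2) := fun i _ => if i < 3 then 1 else 0

def secondHalf : Matrix (Fin 6) Unit (ZMod 2) := fun i _ => if i < 3 then 0 else 1

lemma evenBasis_transpose_mul_self : evenBasisᵀ * evenBasis = J (Fin 2) (ZMod 2) := by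
  decide +kernel

lemma ones_transpose_mul_evenBasis : onesᵀ * evenBasis = 0 := by
  decide +kernel

lemma ones_transpose_mul_ones : onesᵀ * ones = 0 := by
  decide +kernel

lemma evenBasis_mul_J_mul_transpose :
    evenBasis * J (Fin 2) (ZMod 2) * evenBasisᵀ
      = 1 + ones * secondHalfᵀ + firstHalf * onesᵀ := by
  decide +kernel

lemma J_mul_J : J (Fin 2) (ZMod 2) * J (Fin 2) (ZMod 2) = 1 := by
  decide +kernel

lemma evenBasis_transpose_mul_ones : evenBasisᵀ * ones = 0 := by
  simpa using congrArg transpose ones_transpose_mul_evenBasis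

/-- The permutation matrix of `σ⁻¹`, which makes the assignment multiplicative. -/
def permMat (σ : Equiv.Perm (Fin 6)) : Matrix (Fin 6) (Fin 6) (ZMod 2) :=
  σ⁻¹.permMatrix (ZMod 2)

lemma permMat_mul (σ τ : Equiv.Perm (Fin 6)) : permMat (σ * τ) = permMat σ * permMat τ := by
  simp [permMat, Matrix.permMatrix_mul]

lemma permMat_one : permMat 1 = 1 := by
  simp [permMat]

lemma permMat_mul_apply {n : Type*} (σ : Equiv.Perm (Fin 6)) (A : Matrix (Fin 6) n (ZMod 2))
    (i : Fin 6) (j : n) : (permMat σ * A) i j = A (σ⁻¹ i) j := by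
  simp [permMat, Equiv.Perm.permMatrix, PEquiv.toMatrix_toPEquiv_mul]

lemma permMat_mul_ones (σ : Equiv.Perm (Fin 6)) : permMat σ * ones = ones := by
  ext i j
  simp [permMat_mul_apply, ones]

lemma permMat_transpose_mul_self (σ : Equiv.Perm (Fin 6)) : (permMat σ)ᵀ * permMat σ = 1 := by
  have h : (permMat σ)ᵀ = permMat σ⁻¹ := by simp [permMat, Matrix.transpose_permMatrix]
  rw [h, ← permMat_mul, inv_mul_cancel, permMat_one]

lemma ones_transpose_mul_permMat (σ : Equiv.Perm (Fin 6)) : onesᵀ * permMat σ = onesᵀ := by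
  calc onesᵀ * permMat σ = (permMat σ * ones)ᵀ * permMat σ := by rw [permMat_mul_ones]
    _ = onesᵀ * ((permMat σ)ᵀ * permMat σ) := by rw [transpose_mul, Matrix.mul_assoc]
    _ = onesᵀ := by rw [permMat_transpose_mul_self, Matrix.mul_one]

/-- The action of a permutation on even-size subsets modulo complementation. -/
def permAction (σ : Equiv.Perm (Fin 6)) : Matrix (Fin 2 ⊕ Fin 2) (Fin 2 ⊕ Fin 2) (ZMod 2) :=
  J (Fin 2) (ZMod 2) * evenBasisᵀ * permMat σ * evenBasis

lemma evenBasis_mul_permAction (σ : Equiv.Perm (Fin 6)) :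
    evenBasis * permAction σ
      = permMat σ * evenBasis + ones * (secondHalfᵀ * permMat σ * evenBasis) := by
  have h : evenBasis * permAction σ
      = (evenBasis * J (Fin 2) (ZMod 2) * evenBasisᵀ) * (permMat σ * evenBasis) := by
    simp only [permAction, Matrix.mul_assoc]
  have h0 : onesᵀ * (permMat σ * evenBasis) = 0 := by
    rw [← Matrix.mul_assoc, ones_transpose_mul_permMat, ones_transpose_mul_evenBasis]
  rw [h, evenBasis_mul_J_mul_transpose]
  simp only [Matrix.add_mul, Matrix.one_mul, Matrix.mul_assoc, h0, Matrix.mul_zero, add_zero]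

lemma permAction_one : permAction 1 = 1 := by
  rw [permAction, permMat_one, Matrix.mul_one, Matrix.mul_assoc, evenBasis_transpose_mul_self,
    J_mul_J]

lemma permAction_mul (σ τ : Equiv.Perm (Fin 6)) :
    permAction (σ * τ) = permAction σ * permAction τ := by
  have h : permAction σ * permAction τ
      = J (Fin 2) (ZMod 2) * evenBasisᵀ * permMat σ * (evenBasis * permAction τ) := by
    rw [← Matrix.mul_assoc, ← permAction]
  have h0 : J (Fin 2) (ZMod 2) * evenBasisᵀ * permMat σ * ones = 0 := by
    rw [Matrix.mul_assoc, permMat_mul_ones, Matrix.mul_assoc, evenBasis_transpose_mul_ones,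
      Matrix.mul_zero]
  rw [h, evenBasis_mul_permAction, Matrix.mul_add, ← Matrix.mul_assoc _ ones, h0,
    Matrix.zero_mul, add_zero, permAction, permMat_mul]
  simp only [Matrix.mul_assoc]

lemma permAction_transpose_mul_J_mul (σ : Equiv.Perm (Fin 6)) :
    (permAction σ)ᵀ * J (Fin 2) (ZMod 2) * permAction σ = J (Fin 2) (ZMod 2) := by
  have h : (permAction σ)ᵀ * J (Fin 2) (ZMod 2) * permAction σ
      = (evenBasis * permAction σ)ᵀ * (evenBasis * permAction σ) := by
    rw [← evenBasis_transpose_mul_self, transpose_mul]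
    simp only [Matrix.mul_assoc]
  have h1 : onesᵀ * (permMat σ * evenBasis) = 0 := by
    rw [← Matrix.mul_assoc, ones_transpose_mul_permMat, ones_transpose_mul_evenBasis]
  have h2 : (permMat σ * evenBasis)ᵀ * ones = 0 := by
    simpa using congrArg transpose h1
  have h3 : (permMat σ * evenBasis)ᵀ * (permMat σ * evenBasis) = J (Fin 2) (ZMod 2) := by
    rw [transpose_mul, Matrix.mul_assoc, ← Matrix.mul_assoc _ (permMat σ),
      permMat_transpose_mul_self, Matrix.one_mul, evenBasis_transpose_mul_self]
  rw [h, evenBasis_mul_permAction, transpose_add, transpose_mul ones, Matrix.add_mul,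
    Matrix.mul_add, Matrix.mul_add, h3, ← Matrix.mul_assoc _ ones, h2, Matrix.mul_assoc _ onesᵀ,
    h1, Matrix.mul_assoc _ onesᵀ, ← Matrix.mul_assoc onesᵀ ones, ones_transpose_mul_ones]
  simp

lemma permAction_mem (σ : Equiv.Perm (Fin 6)) :
    permAction σ ∈ symplecticGroup (Fin 2) (ZMod 2) := by
  rw [← SymplecticGroup.transpose_mem_iff, SymplecticGroup.mem_iff, transpose_transpose]
  exact permAction_transpose_mul_J_mul σ

/-- The homomorphism from `S₆` to `Sp(4, 𝔽₂)`. -/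
def permHom : Equiv.Perm (Fin 6) →* symplecticGroup (Fin 2) (ZMod 2) where
  toFun σ := ⟨permAction σ, permAction_mem σ⟩
  map_one' := Subtype.ext permAction_one
  map_mul' σ τ := Subtype.ext (permAction_mul σ τ)

lemma evenBasis_injective : Function.Injective evenBasis := by
  have h : ∀ p : Fin 6 × Fin 6, evenBasis p.1 = evenBasis p.2 → p.1 = p.2 := by decide +kernel
  exact fun i j => h (i, j)

/-- No nontrivial translation preserves the set of rows of `evenBasis`. -/
lemma eq_zero_of_translate (v : Fin 2 ⊕ Fin 2 → ZMod 2)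
    (h : ∀ i, ∃ j, evenBasis i = evenBasis j + v) : v = 0 := by
  revert v
  decide +kernel

lemma permHom_injective : Function.Injective permHom := by
  rw [injective_iff_map_eq_one]
  intro σ hσ
  have h1 : permAction σ = 1 := congrArg Subtype.val hσ
  have h2 := evenBasis_mul_permAction σ
  rw [h1, Matrix.mul_one] at h2
  set w := secondHalfᵀ * permMat σ * evenBasis
  have h3 (i : Fin 6) : evenBasis i = evenBasis (σ⁻¹ i) + w () := by
    ext j
    have h := congrFun (congrFun h2 i) j
    rw [Matrix.add_apply, permMat_mul_apply] at h
    simpa [Matrix.mul_apply, ones] using h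
  have h4 : w () = 0 := eq_zero_of_translate _ fun i => ⟨_, h3 i⟩
  rw [← inv_eq_one]
  ext1 i
  refine (evenBasis_injective ?_).symm
  simpa [h4] using h3 i

/-- Vectors of `𝔽₂⁴` as tuples. -/
abbrev Vec := ZMod 2 × ZMod 2 × ZMod 2 × ZMod 2

/-- The standard symplectic form on `𝔽₂⁴`. -/
def form (a b : Vec) : ZMod 2 :=
  a.1 * b.2.2.1 + a.2.1 * b.2.2.2 + a.2.2.1 * b.1 + a.2.2.2 * b.2.1

/-- The symplectic bases of `𝔽₂⁴`. -/
def symplecticBases : Finset (Σ _ : Vec, Σ _ : Vec, Σ _ : Vec, Vec) :=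
  Finset.univ.sigma fun a =>
    (Finset.univ.filter fun b => form a b = 1).sigma fun b =>
      (Finset.univ.filter fun c => form a c = 0 ∧ form b c = 0).sigma fun c =>
        Finset.univ.filter fun d => form c d = 1 ∧ form a d = 0 ∧ form b d = 0

lemma card_symplecticBases : symplecticBases.card = 720 := by
  simp only [symplecticBases, Finset.card_sigma]
  decide +kernel

def row (M : Matrix (Fin 2 ⊕ Fin 2) (Fin 2 ⊕ Fin 2) (ZMod 2)) (i : Fin 2 ⊕ Fin 2) : Vec :=
  (M i (.inl 0), M i (.inl 1), M i (.inr 0), M i (.inr 1))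

def rows (M : Matrix (Fin 2 ⊕ Fin 2) (Fin 2 ⊕ Fin 2) (ZMod 2)) :
    Σ _ : Vec, Σ _ : Vec, Σ _ : Vec, Vec :=
  ⟨row M (.inl 0), row M (.inr 0), row M (.inl 1), row M (.inr 1)⟩

lemma rows_injective : Function.Injective rows := by
  intro M N h
  simp only [rows, row, Sigma.mk.injEq, heq_eq_eq, Prod.mk.injEq] at h
  ext i j
  fin_cases i <;> fin_cases j <;> simp [h]

lemma form_row (M : Matrix (Fin 2 ⊕ Fin 2) (Fin 2 ⊕ Fin 2) (ZMod 2)) (i j : Fin 2 ⊕ Fin 2) :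
    form (row M i) (row M j) = (M * J (Fin 2) (ZMod 2) * Mᵀ) i j := by
  simp [form, row, Matrix.mul_apply, J, Matrix.fromBlocks, Matrix.one_apply, CharTwo.neg_eq]
  ring

lemma rows_mem_symplecticBases {M : Matrix (Fin 2 ⊕ Fin 2) (Fin 2 ⊕ Fin 2) (ZMod 2)}
    (hM : M ∈ symplecticGroup (Fin 2) (ZMod 2)) : rows M ∈ symplecticBases := by
  rw [SymplecticGroup.mem_iff] at hM
  simp only [symplecticBases, rows, Finset.mem_sigma, Finset.mem_filter, Finset.mem_univ,
    true_and, form_row, hM]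
  decide +kernel

lemma card_symplecticGroup_le : Nat.card (symplecticGroup (Fin 2) (ZMod 2)) ≤ 720 := by
  rw [← card_symplecticBases, ← Fintype.card_coe, ← Nat.card_eq_fintype_card]
  refine Nat.card_le_card_of_injective
    (fun M : symplecticGroup (Fin 2) (ZMod 2) =>
      (⟨rows M, rows_mem_symplecticBases M.2⟩ : symplecticBases)) fun M N h => ?_
  exact Subtype.ext (rows_injective (congrArg Subtype.val h))

lemma card_perm : Nat.card (Equiv.Perm (Fin 6)) = 720 := by
  rw [Nat.card_perm, Nat.card_fin]
  rfl

lemma permHom_bijective : Function.Bijective permHom :=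
  permHom_injective.bijective_of_nat_card_le (card_symplecticGroup_le.trans card_perm.ge)

end SymplecticFour

/-- The symplectic group `Sp(4, 𝔽₂)` has exactly 720 elements and is isomorphic,
as a group, to the symmetric group on six letters. -/
theorem stmt_1 :
    Nat.card (Matrix.symplecticGroup (Fin 2) (ZMod 2)) = 720 ∧
    Nonempty (Matrix.symplecticGroup (Fin 2) (ZMod 2) ≃* Equiv.Perm (Fin 6)) := by
  let e := MulEquiv.ofBijective SymplecticFour.permHom SymplecticFour.permHom_bijective
  exact ⟨(Nat.card_congr e.toEquiv).symm.trans SymplecticFour.card_perm, ⟨e.symm⟩⟩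
end

section
/- In the setting of the random self-reduction theorem (G a finite group acting on a finite type S, F ≤ H ≤ G with H ⊴ G, A : (Fin (2n+1) → G) → PMF S, and B, D defined from A as there), suppose additionally g : Fin n → G satisfies (g i) * (g i) = 1 for all i, let π := g 0 * ⋯ * g (n−1), and assume π * f * π⁻¹ ∈ F for all f ∈ F. For f ∈ F let ĝ(f) : Fin (2n+1) → G be the tuple (g 0, …, g (n−1), f, g (n−1), …, g 0). Then for every f ∈ F, B(ĝ(f)) = PMF.map (fun s => (π * f * π⁻¹) • s) (D(ĝ(1))); in particular the distribution D appearing on the right does not depend on f. -/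
open scoped Classical

namespace Stmt6

variable {G : Type*} [Group G] [Fintype G] {S : Type*} [Fintype S] [MulAction G S]

/-- The ordered product `g 0 * g 1 * ⋯ * g (k−1)`. -/
def listProd {k : ℕ} (g : Fin k → G) : G := (List.ofFn g).prod

/-- The set `T(g)` of tuples `g'` with `Πg' * (Πg)⁻¹ ∈ F` and `(g i)⁻¹ * g' i ∈ H`
for all `i`. -/
noncomputable def Tset (F H : Subgroup G) {k : ℕ} (g : Fin k → G) : Finset (Fin k → G) :=
  Finset.univ.filter fun g' =>
    listProd g' * (listProd g)⁻¹ ∈ F ∧ ∀ i, (g i)⁻¹ * g' i ∈ H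

lemma Tset_nonempty (F H : Subgroup G) {k : ℕ} (g : Fin k → G) : (Tset F H g).Nonempty := by
  refine ⟨g, Finset.mem_filter.mpr ⟨Finset.mem_univ _, ?_, fun i => ?_⟩⟩
  · simpa using F.one_mem
  · simpa using H.one_mem

/-- The distribution `D(g)`: draw `g'` uniformly from `T(g)`, then draw `s` from `A g'`,
and output `(Πg')⁻¹ • s`. -/
noncomputable def Dpmf (F H : Subgroup G) {k : ℕ} (A : (Fin k → G) → PMF S)
    (g : Fin k → G) : PMF S :=
  (PMF.uniformOfFinset (Tset F H g) (Tset_nonempty F H g)).bind fun g' =>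
    (A g').map fun s => (listProd g')⁻¹ • s

/-- The Kilian randomization map sending `h` to
`(g 0 * h 0, (h 0)⁻¹ * g 1 * h 1, …, (h (k−2))⁻¹ * g (k−1))`. -/
def kilian (H : Subgroup G) {k : ℕ} (g : Fin k → G) (h : Fin (k - 1) → H) : Fin k → G :=
  fun i =>
    (if hi : 0 < i.val then
        ((h ⟨i.val - 1, by have := i.isLt; omega⟩ : G))⁻¹ else 1) * g i *
    (if hj : i.val < k - 1 then (h ⟨i.val, hj⟩ : G) else 1)

/-- The distribution `B(g)`: draw `f` uniformly from `F` and `h : Fin (k−1) → H`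
uniformly, form the Kilian-randomized tuple with first entry `f * g 0 * h 0`, middle
entries `(h (i−1))⁻¹ * g i * h i`, last entry `(h (k−2))⁻¹ * g (k−1)`, draw `s` from
`A` applied to it, and output `f⁻¹ • s`. -/
noncomputable def Bpmf (F H : Subgroup G) {k : ℕ} (hk : 0 < k)
    (A : (Fin k → G) → PMF S) (g : Fin k → G) : PMF S :=
  letI : Nonempty F := ⟨1⟩
  letI : Nonempty H := ⟨1⟩
  (PMF.uniformOfFintype F).bind fun f =>
    (PMF.uniformOfFintype (Fin (k - 1) → H)).bind fun h =>
      (A (kilian H (Function.update g ⟨0, hk⟩ ((f : G) * g ⟨0, hk⟩)) h)).map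
        fun s => (f : G)⁻¹ • s

/-- The palindrome tuple `ĝ(f) = (g 0, …, g (n−1), f, g (n−1), …, g 0)`. -/
def ghat {n : ℕ} (g : Fin n → G) (f : G) : Fin (2 * n + 1) → G := fun i =>
  if h : i.val < n then g ⟨i.val, h⟩
  else if h' : i.val = n then f
  else g ⟨2 * n - i.val, by have := i.isLt; omega⟩

lemma bind_uniformOfFintype_bind {α β γ σ : Type*} [Fintype α] [Nonempty α] [Fintype β]
    [Nonempty β] (T : Finset γ) (hT : T.Nonempty) (e : α × β → γ)
    (he : Set.BijOn e Set.univ T) (φ : γ → PMF σ) :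
    ((PMF.uniformOfFintype α).bind fun a => (PMF.uniformOfFintype β).bind fun b => φ (e (a, b))) =
      (PMF.uniformOfFinset T hT).bind φ := by
  have himg : Finset.univ.image e = T := by
    apply Finset.coe_injective
    simpa using he.image_eq
  have hinj : Function.Injective e := Set.injOn_univ.mp he.injOn
  have hcard : T.card = Fintype.card α * Fintype.card β := by
    rw [← himg, Finset.card_image_of_injective _ hinj, Finset.card_univ, Fintype.card_prod]
  ext s
  have hD : ∀ c, c ∉ T → (PMF.uniformOfFinset T hT) c * φ c s = 0 := fun c hc => by
    rw [PMF.uniformOfFinset_apply_of_notMem hT hc, zero_mul]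
  rw [PMF.bind_apply, PMF.bind_apply, tsum_eq_sum (s := T) fun c hc => hD c hc]
  have hsum : ∀ u : γ → ENNReal, ∑ c ∈ T, u c = ∑ p : α × β, u (e p) := fun u => by
    rw [← himg, Finset.sum_image fun _ _ _ _ h => hinj h]
  rw [hsum, tsum_fintype, Fintype.sum_prod_type]
  refine Finset.sum_congr rfl fun a _ => ?_
  rw [PMF.bind_apply, tsum_fintype, Finset.mul_sum]
  refine Finset.sum_congr rfl fun b _ => ?_
  have hmem : e (a, b) ∈ T := he.mapsTo (Set.mem_univ _)
  rw [PMF.uniformOfFinset_apply_of_mem hT hmem, hcard, PMF.uniformOfFintype_apply,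
    PMF.uniformOfFintype_apply, Nat.cast_mul,
    ENNReal.mul_inv (Or.inr (ENNReal.natCast_ne_top _)) (Or.inl (ENNReal.natCast_ne_top _)),
    mul_assoc]

section TupleProducts

variable {M : Type*} [Group M]

/-- The product of the first `j` entries of a tuple. -/
def prefixProd {k : ℕ} (g : Fin k → M) (j : ℕ) : M := ((List.ofFn g).take j).prod

lemma prefixProd_zero {k : ℕ} (g : Fin k → M) : prefixProd g 0 = 1 := by
  simp [prefixProd]

lemma prefixProd_succ {k : ℕ} (g : Fin k → M) {j : ℕ} (hj : j < k) :
    prefixProd g (j + 1) = prefixProd g j * g ⟨j, hj⟩ := by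
  unfold prefixProd
  rw [List.prod_take_succ _ _ (by simpa using hj)]
  simp

lemma prefixProd_self {k : ℕ} (g : Fin k → M) : prefixProd g k = (List.ofFn g).prod := by
  unfold prefixProd
  rw [List.take_of_length_le (by simp)]

lemma eq_of_prefixProd_succ_eq {k : ℕ} {g g' : Fin k → M}
    (h : ∀ j < k, prefixProd g (j + 1) = prefixProd g' (j + 1)) : g = g' := by
  funext ⟨j, hj⟩
  have h' : prefixProd g j = prefixProd g' j := by
    cases j with
    | zero => simp [prefixProd_zero]
    | succ j => exact h j (by omega)
  have := h j hj
  rwa [prefixProd_succ g hj, prefixProd_succ g' hj, h', mul_right_inj] at this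

lemma mk_prefixProd_eq (H : Subgroup M) [H.Normal] {k : ℕ} {g g' : Fin k → M}
    (h : ∀ i, (g i)⁻¹ * g' i ∈ H) {j : ℕ} (hj : j ≤ k) :
    ((prefixProd g j : M) : M ⧸ H) = (prefixProd g' j : M) := by
  induction j with
  | zero => simp [prefixProd_zero]
  | succ j ih =>
    rw [prefixProd_succ g hj, prefixProd_succ g' hj, QuotientGroup.mk_mul, QuotientGroup.mk_mul,
      ih (by omega), QuotientGroup.eq.mpr (h ⟨j, hj⟩)]

/-- The Kilian randomization of `g` with its first entry multiplied on the left by `f`. -/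
noncomputable def shiftedKilian (F H : Subgroup M) {m : ℕ} (g : Fin (m + 1) → M)
    (p : F × (Fin m → H)) : Fin (m + 1) → M :=
  kilian H (Function.update g ⟨0, m.succ_pos⟩ ((p.1 : M) * g ⟨0, m.succ_pos⟩)) p.2

lemma prefixProd_shiftedKilian (F H : Subgroup M) {m : ℕ} (g : Fin (m + 1) → M)
    (p : F × (Fin m → H)) {j : ℕ} (hj : j < m + 1) :
    prefixProd (shiftedKilian F H g p) (j + 1) =
      p.1 * prefixProd g (j + 1) * (if h : j < m then (p.2 ⟨j, h⟩ : M) else 1) := by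
  induction j with
  | zero =>
    simp [prefixProd_succ _ hj, prefixProd_zero, shiftedKilian, kilian]
  | succ j ih =>
    have hjm : j < m := by omega
    rw [prefixProd_succ _ hj, ih (by omega), prefixProd_succ g hj]
    simp [shiftedKilian, kilian, hjm, mul_assoc]

lemma listProd_shiftedKilian (F H : Subgroup M) {m : ℕ} (g : Fin (m + 1) → M)
    (p : F × (Fin m → H)) :
    listProd (shiftedKilian F H g p) = p.1 * listProd g := by
  have := prefixProd_shiftedKilian F H g p m.lt_succ_self
  simpa [prefixProd_self, listProd] using this

lemma listProd_ghat {n : ℕ} (g : Fin n → M) (hg : ∀ i, g i * g i = 1) (f : M) :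
    listProd (ghat g f) = listProd g * f * (listProd g)⁻¹ := by
  have hlist : List.ofFn (ghat g f) = List.ofFn g ++ f :: (List.ofFn g).reverse := by
    apply List.ext_getElem
    · simp; omega
    · intro i h₁ h₂
      simp only [List.length_ofFn] at h₁
      rw [List.getElem_append]
      rcases lt_trichotomy i n with hi | rfl | hi
      · simp [ghat, hi, -List.ofFn_succ]
      · simp [ghat, -List.ofFn_succ]
      · obtain ⟨d, rfl⟩ := Nat.exists_eq_add_of_lt hi
        have hd : n + d + 1 - n = d + 1 := by omega
        have hi' : ¬n + d + 1 < n := by omega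
        have hne : ¬n + d + 1 = n := by omega
        simp only [List.getElem_ofFn, ghat, List.length_ofFn, hi', hne, dif_neg, not_false_eq_true,
          hd, List.getElem_cons_succ, List.getElem_reverse]
        congr 2
        omega
  have hinv : (listProd g)⁻¹ = (List.ofFn g).reverse.prod := by
    have : (fun i => (g i)⁻¹) = g := funext fun i => inv_eq_of_mul_eq_one_left (hg i)
    rw [listProd, List.prod_inv_reverse, List.map_ofFn]
    exact congrArg (fun t => (List.ofFn t).reverse.prod) this
  rw [hinv, listProd, hlist]
  simp [listProd, mul_assoc]

end TupleProducts

lemma shiftedKilian_mem_Tset {F H : Subgroup G} (hFH : F ≤ H) [H.Normal] {m : ℕ}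
    (g : Fin (m + 1) → G) (p : F × (Fin m → H)) :
    shiftedKilian F H g p ∈ Tset F H g := by
  refine Finset.mem_filter.mpr ⟨Finset.mem_univ _, ?_, fun i => ?_⟩
  · simp [listProd_shiftedKilian]
  · have hH : ∀ x : H, ((x : G) : G ⧸ H) = 1 := fun x => (QuotientGroup.eq_one_iff _).mpr x.2
    have hF : ((p.1 : G) : G ⧸ H) = 1 := (QuotientGroup.eq_one_iff _).mpr (hFH p.1.2)
    rw [← QuotientGroup.eq]
    unfold shiftedKilian kilian
    rcases eq_or_ne i ⟨0, m.succ_pos⟩ with rfl | hi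
    · rw [dif_neg (by simp), Function.update_self]
      split_ifs <;> simp [hF]
    · rw [Function.update_of_ne hi]
      split_ifs <;> simp_all

lemma bijOn_shiftedKilian {F H : Subgroup G} (hFH : F ≤ H) [H.Normal] {m : ℕ}
    (g : Fin (m + 1) → G) :
    Set.BijOn (shiftedKilian F H g) Set.univ (Tset F H g) := by
  refine ⟨fun p _ => shiftedKilian_mem_Tset hFH g p, ?_, ?_⟩
  · intro p _ q _ hpq
    have h₁ : p.1 = q.1 := by
      have := congrArg listProd hpq
      rw [listProd_shiftedKilian, listProd_shiftedKilian, mul_left_inj] at this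
      exact Subtype.ext this
    refine Prod.ext h₁ (funext fun j => Subtype.ext ?_)
    have := congrArg (prefixProd · (j.val + 1)) hpq
    simpa [prefixProd_shiftedKilian F H g _ (show j.val < m + 1 by omega), h₁] using this
  · intro g' hg'
    obtain ⟨-, hF, hH⟩ := Finset.mem_filter.mp (Finset.mem_coe.mp hg')
    set f := listProd g' * (listProd g)⁻¹ with hf
    have hmem : ∀ j : Fin m, (f * prefixProd g (j.val + 1))⁻¹ * prefixProd g' (j.val + 1) ∈ H := by
      intro j
      rw [← QuotientGroup.eq, QuotientGroup.mk_mul, (QuotientGroup.eq_one_iff f).mpr (hFH hF),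
        one_mul, mk_prefixProd_eq H hH (by omega)]
    refine ⟨⟨⟨f, hF⟩, fun j => ⟨_, hmem j⟩⟩, Set.mem_univ _, eq_of_prefixProd_succ_eq ?_⟩
    intro j hj
    rw [prefixProd_shiftedKilian F H g _ hj]
    by_cases hjm : j < m
    · simp only [hjm, dif_pos, mul_inv_cancel_left]
    · obtain rfl : j = m := by omega
      simp [prefixProd_self, hf, listProd, -List.ofFn_succ]

/-- The self-reduction `B(g)` is `D(g)` translated by the product of `g`. -/
lemma Bpmf_eq_map_Dpmf {F H : Subgroup G} (hFH : F ≤ H) [H.Normal] {σ : Type*}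
    [MulAction G σ] {m : ℕ} (A : (Fin (m + 1) → G) → PMF σ) (g : Fin (m + 1) → G) :
    Bpmf F H m.succ_pos A g = (Dpmf F H A g).map fun s => listProd g • s := by
  have : Nonempty F := ⟨1⟩
  have : Nonempty H := ⟨1⟩
  have key := bind_uniformOfFintype_bind (Tset F H g) (Tset_nonempty F H g)
    (shiftedKilian F H g) (bijOn_shiftedKilian hFH g)
    (fun g' => (A g').map fun s => (listProd g * (listProd g')⁻¹) • s)
  simp only [listProd_shiftedKilian, mul_inv_rev, mul_inv_cancel_left] at key
  unfold Dpmf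
  rw [PMF.map_bind]
  simp only [PMF.map_comp, Function.comp_def, smul_smul]
  exact key

lemma Tset_ghat {F H : Subgroup G} (hFH : F ≤ H) {n : ℕ} (g : Fin n → G)
    (hg : ∀ i, g i * g i = 1) (hπ : ∀ f ∈ F, listProd g * f * (listProd g)⁻¹ ∈ F)
    {f : G} (hf : f ∈ F) :
    Tset F H (ghat g f) = Tset F H (ghat g 1) := by
  have hmid : ∀ (i : Fin (2 * n + 1)) (x : G),
      (ghat g f i)⁻¹ * x ∈ H ↔ (ghat g 1 i)⁻¹ * x ∈ H := by
    intro i x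
    unfold ghat
    split_ifs
    · rfl
    · simp [H.mul_mem_cancel_left (H.inv_mem (hFH hf))]
    · rfl
  ext g'
  simp only [Tset, Finset.mem_filter, Finset.mem_univ, true_and, hmid]
  rw [listProd_ghat g hg, listProd_ghat g hg, F.mul_mem_cancel_right (F.inv_mem (hπ f hf)),
    F.mul_mem_cancel_right (F.inv_mem (hπ 1 F.one_mem))]

/-- If all `g i` are involutions, `π := g 0 * ⋯ * g (n−1)`, and conjugation by `π`
preserves `F`, then for every `f ∈ F`,
`B(ĝ(f)) = (π * f * π⁻¹) • D(ĝ(1))`; in particular the distribution `D(ĝ(1))` on the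
right does not depend on `f`. -/
theorem stmt_6 {n : ℕ} (F H : Subgroup G) (hFH : F ≤ H) [H.Normal]
    (A : (Fin (2 * n + 1) → G) → PMF S) (g : Fin n → G)
    (hg : ∀ i, g i * g i = 1)
    (hπ : ∀ f ∈ F, listProd g * f * (listProd g)⁻¹ ∈ F) :
    ∀ f ∈ F,
      Bpmf F H (Nat.succ_pos _) A (ghat g f) =
        PMF.map (fun s => (listProd g * f * (listProd g)⁻¹) • s)
          (Dpmf F H A (ghat g 1)) := by
  intro f hf
  have hD : Dpmf F H A (ghat g f) = Dpmf F H A (ghat g 1) := by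
    simp only [Dpmf, Tset_ghat hFH g hg hπ hf]
  rw [← hD, ← listProd_ghat g hg f]
  exact Bpmf_eq_map_Dpmf hFH A (ghat g f)

end Stmt6
end

section
/- Let 𝒫 be the set of 15 two-qubit Pauli strings (Kronecker products P ⊗ Q with P, Q ∈ {1, X, Y, Z}, excluding 1 ⊗ 1). Call a 3-element subset {P, Q, R} ⊆ 𝒫 a Pauli line if its elements pairwise commute and P * Q * R = ε • 1 for some ε ∈ {1, −1} (ε is the sign of the line). Then: (i) there are exactly 15 Pauli lines; (ii) every element of 𝒫 belongs to exactly 3 Pauli lines; (iii) the five sets {X⊗1, 1⊗X, X⊗X}, {Y⊗1, 1⊗Y, Y⊗Y}, {Z⊗1, 1⊗Z, Z⊗Z}, {X⊗Y, Y⊗Z, Z⊗X}, {Y⊗X, Z⊗Y, X⊗Z} are pairwise disjoint Pauli lines whose union is 𝒫. -/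
open Kronecker

namespace Stmt13

/-- The Pauli matrix `X`. -/
noncomputable def σx : Matrix (Fin 2) (Fin 2) ℂ := !![0, 1; 1, 0]

/-- The Pauli matrix `Y`. -/
noncomputable def σy : Matrix (Fin 2) (Fin 2) ℂ := !![0, -Complex.I; Complex.I, 0]

/-- The Pauli matrix `Z`. -/
noncomputable def σz : Matrix (Fin 2) (Fin 2) ℂ := !![1, 0; 0, -1]

/-- The set `{1, X, Y, Z}` of one-qubit Pauli matrices. -/
noncomputable def pauli1 : Set (Matrix (Fin 2) (Fin 2) ℂ) := {1, σx, σy, σz}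

/-- The set `𝒫` of the 15 two-qubit Pauli strings: Kronecker products `P ⊗ Q` with
`P, Q ∈ {1, X, Y, Z}`, excluding `1 ⊗ 1`. -/
noncomputable def pauliStrings : Set (Matrix (Fin 2 × Fin 2) (Fin 2 × Fin 2) ℂ) :=
  {A | (∃ P ∈ pauli1, ∃ Q ∈ pauli1, A = P ⊗ₖ Q) ∧
    A ≠ (1 : Matrix (Fin 2) (Fin 2) ℂ) ⊗ₖ (1 : Matrix (Fin 2) (Fin 2) ℂ)}

/-- A Pauli line: a 3-element subset `{P, Q, R}` of `𝒫` whose elements pairwise commute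
and with `P * Q * R = ε • 1` for some sign `ε ∈ {1, −1}`. -/
def IsPauliLine (L : Set (Matrix (Fin 2 × Fin 2) (Fin 2 × Fin 2) ℂ)) : Prop :=
  ∃ P Q R : Matrix (Fin 2 × Fin 2) (Fin 2 × Fin 2) ℂ,
    P ∈ pauliStrings ∧ Q ∈ pauliStrings ∧ R ∈ pauliStrings ∧
    P ≠ Q ∧ P ≠ R ∧ Q ≠ R ∧ L = {P, Q, R} ∧
    P * Q = Q * P ∧ P * R = R * P ∧ Q * R = R * Q ∧
    ∃ ε : ℂ, (ε = 1 ∨ ε = -1) ∧ P * Q * R = ε • (1 : Matrix (Fin 2 × Fin 2) (Fin 2 × Fin 2) ℂ)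

/-- One-qubit Pauli matrices indexed by `(ℤ/2)²`: `(1, 0) ↦ X`, `(1, 1) ↦ Y`, `(0, 1) ↦ Z`. -/
noncomputable def pauli (a : ZMod 2 × ZMod 2) : Matrix (Fin 2) (Fin 2) ℂ :=
  if a = (0, 0) then 1 else if a = (1, 0) then σx else if a = (1, 1) then σy else σz

lemma pauli_zero : pauli (0, 0) = 1 := by simp [pauli]

lemma pauli_one_zero : pauli (1, 0) = σx := by simp [pauli]

lemma pauli_one_one : pauli (1, 1) = σy := by simp [pauli]

lemma pauli_zero_one : pauli (0, 1) = σz := by simp [pauli]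

lemma forall_zmod_two_prod {p : ZMod 2 × ZMod 2 → Prop} (h00 : p (0, 0)) (h10 : p (1, 0))
    (h11 : p (1, 1)) (h01 : p (0, 1)) (a : ZMod 2 × ZMod 2) : p a := by
  obtain rfl | rfl | rfl | rfl :=
    (by decide : ∀ a : ZMod 2 × ZMod 2, a = (0, 0) ∨ a = (1, 0) ∨ a = (1, 1) ∨ a = (0, 1)) a <;>
  assumption

lemma σx_mul_σx : σx * σx = 1 := by ext i j; fin_cases i <;> fin_cases j <;> simp [σx]

lemma σy_mul_σy : σy * σy = 1 := by ext i j; fin_cases i <;> fin_cases j <;> simp [σy]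

lemma σz_mul_σz : σz * σz = 1 := by ext i j; fin_cases i <;> fin_cases j <;> simp [σz]

lemma σx_mul_σy : σx * σy = Complex.I • σz := by
  ext i j; fin_cases i <;> fin_cases j <;> simp [σx, σy, σz]

lemma σy_mul_σx : σy * σx = -Complex.I • σz := by
  ext i j; fin_cases i <;> fin_cases j <;> simp [σx, σy, σz]

lemma σy_mul_σz : σy * σz = Complex.I • σx := by
  ext i j; fin_cases i <;> fin_cases j <;> simp [σx, σy, σz]

lemma σz_mul_σy : σz * σy = -Complex.I • σx := by
  ext i j; fin_cases i <;> fin_cases j <;> simp [σx, σy, σz]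

lemma σz_mul_σx : σz * σx = Complex.I • σy := by
  ext i j; fin_cases i <;> fin_cases j <;> simp [σx, σy, σz]

lemma σx_mul_σz : σx * σz = -Complex.I • σy := by
  ext i j; fin_cases i <;> fin_cases j <;> simp [σx, σy, σz]

lemma range_pauli : Set.range pauli = pauli1 := by
  ext A
  constructor
  · rintro ⟨a, rfl⟩
    revert a
    apply forall_zmod_two_prod <;> simp [pauli1, pauli]
  · rintro (rfl | rfl | rfl | rfl)
    exacts [⟨_, pauli_zero⟩, ⟨_, pauli_one_zero⟩, ⟨_, pauli_one_one⟩, ⟨_, pauli_zero_one⟩]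

lemma pauli_mul_self (a : ZMod 2 × ZMod 2) : pauli a * pauli a = 1 := by
  revert a
  apply forall_zmod_two_prod <;>
    simp only [pauli_zero, pauli_one_zero, pauli_one_one, pauli_zero_one, mul_one, σx_mul_σx,
      σy_mul_σy, σz_mul_σz]

lemma exists_pauli_mul (a b : ZMod 2 × ZMod 2) :
    ∃ c : ℂ, pauli a * pauli b = c • pauli (a + b) := by
  have h : (1 + 1 : ZMod 2) = 0 := rfl
  revert a b
  apply forall_zmod_two_prod <;> apply forall_zmod_two_prod <;>
    simp only [Prod.mk_add_mk, h, add_zero, zero_add, pauli_zero, pauli_one_zero, pauli_one_one,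
      pauli_zero_one, mul_one, one_mul, σx_mul_σx, σy_mul_σy, σz_mul_σz, σx_mul_σy, σy_mul_σx,
      σy_mul_σz, σz_mul_σy, σz_mul_σx, σx_mul_σz] <;>
    first
    | exact ⟨_, rfl⟩
    | exact ⟨1, (one_smul _ _).symm⟩

lemma trace_pauli_of_ne_zero {a : ZMod 2 × ZMod 2} (ha : a ≠ 0) : (pauli a).trace = 0 := by
  revert a
  apply forall_zmod_two_prod <;> simp [pauli, σx, σy, σz, Matrix.trace_fin_two]

/-- The symplectic form on `(ℤ/2)²`. -/
def symp (a b : ZMod 2 × ZMod 2) : ZMod 2 := a.1 * b.2 + a.2 * b.1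

/-- The nontrivial complex-valued additive character of `ℤ/2`. -/
def sgn (x : ZMod 2) : ℂ := if x = 0 then 1 else -1

lemma sgn_add (x y : ZMod 2) : sgn (x + y) = sgn x * sgn y := by
  have h : (1 + 1 : ZMod 2) = 0 := rfl
  have h01 : ∀ x : ZMod 2, x = 0 ∨ x = 1 := by decide
  obtain rfl | rfl := h01 x <;> obtain rfl | rfl := h01 y <;> simp [sgn, h]

lemma sgn_eq_one_iff {x : ZMod 2} : sgn x = 1 ↔ x = 0 := by
  unfold sgn
  split_ifs with h
  · simp [h]
  · simp only [h, iff_false]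
    norm_num

lemma pauli_mul_comm (a b : ZMod 2 × ZMod 2) :
    pauli a * pauli b = sgn (symp a b) • (pauli b * pauli a) := by
  have h : (1 + 1 : ZMod 2) = 0 := rfl
  revert a b
  apply forall_zmod_two_prod <;> apply forall_zmod_two_prod <;>
    simp [symp, sgn, h, pauli_zero, pauli_one_zero, pauli_one_one, pauli_zero_one, σx_mul_σy,
      σy_mul_σx, σy_mul_σz, σz_mul_σy, σz_mul_σx, σx_mul_σz]

/-- The index set of two-qubit Pauli strings. -/
abbrev Idx : Type := (ZMod 2 × ZMod 2) × (ZMod 2 × ZMod 2)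

/-- The two-qubit Pauli string with a given index. -/
noncomputable def pauli2 (s : Idx) : Matrix (Fin 2 × Fin 2) (Fin 2 × Fin 2) ℂ :=
  pauli s.1 ⊗ₖ pauli s.2

/-- The symplectic form on the indices of two-qubit Pauli strings. -/
def symp2 (s t : Idx) : ZMod 2 := symp s.1 t.1 + symp s.2 t.2

lemma pauli2_zero : pauli2 0 = 1 := by
  rw [pauli2, Prod.fst_zero, Prod.snd_zero, Prod.zero_eq_mk, pauli_zero, Matrix.one_kronecker_one]

lemma pauli2_mul (s t : Idx) :
    pauli2 s * pauli2 t = (pauli s.1 * pauli t.1) ⊗ₖ (pauli s.2 * pauli t.2) :=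
  (Matrix.mul_kronecker_mul ..).symm

lemma pauli2_mul_self (s : Idx) : pauli2 s * pauli2 s = 1 := by
  simp [pauli2_mul, pauli_mul_self]

lemma pauli2_mul_comm (s t : Idx) :
    pauli2 s * pauli2 t = sgn (symp2 s t) • (pauli2 t * pauli2 s) := by
  rw [pauli2_mul, pauli2_mul, pauli_mul_comm s.1, pauli_mul_comm s.2, Matrix.smul_kronecker,
    Matrix.kronecker_smul, smul_smul, symp2, sgn_add]

lemma exists_pauli2_mul (s t : Idx) : ∃ c : ℂ, pauli2 s * pauli2 t = c • pauli2 (s + t) := by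
  obtain ⟨c, hc⟩ := exists_pauli_mul s.1 t.1
  obtain ⟨d, hd⟩ := exists_pauli_mul s.2 t.2
  refine ⟨c * d, ?_⟩
  rw [pauli2_mul, hc, hd, Matrix.smul_kronecker, Matrix.kronecker_smul, smul_smul]
  rfl

lemma trace_pauli2_of_ne_zero {s : Idx} (hs : s ≠ 0) : (pauli2 s).trace = 0 := by
  rw [pauli2, Matrix.trace_kronecker]
  by_cases h : s.1 = 0
  · have h' : s.2 ≠ 0 := fun h' => hs (Prod.ext h h')
    rw [trace_pauli_of_ne_zero h', mul_zero]
  · rw [trace_pauli_of_ne_zero h, zero_mul]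

lemma eq_zero_of_smul_pauli2_eq {s : Idx} {c d : ℂ} (hd : d ≠ 0)
    (h : c • pauli2 s = d • (1 : Matrix (Fin 2 × Fin 2) (Fin 2 × Fin 2) ℂ)) : s = 0 := by
  by_contra hs
  have := congrArg Matrix.trace h
  simp [trace_pauli2_of_ne_zero hs, hd] at this

lemma add_eq_zero_iff_eq (s t : Idx) : s + t = 0 ↔ s = t := by
  rw [add_eq_zero_iff_eq_neg, (by decide : ∀ t : Idx, -t = t)]

lemma pauli2_injective : Function.Injective pauli2 := by
  intro s t h
  obtain ⟨c, hc⟩ := exists_pauli2_mul s t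
  rw [h, pauli2_mul_self, ← one_smul ℂ (1 : Matrix _ _ ℂ)] at hc
  exact (add_eq_zero_iff_eq s t).1 (eq_zero_of_smul_pauli2_eq one_ne_zero hc.symm)

lemma pauli2_mul_comm_iff (s t : Idx) :
    pauli2 s * pauli2 t = pauli2 t * pauli2 s ↔ symp2 s t = 0 := by
  rw [pauli2_mul_comm, ← sgn_eq_one_iff]
  refine ⟨fun h => ?_, fun h => by rw [h, one_smul]⟩
  have h' := congrArg (· * (pauli2 s * pauli2 t)) h
  have h1 : pauli2 t * pauli2 s * (pauli2 s * pauli2 t) = 1 := by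
    rw [mul_assoc, ← mul_assoc (pauli2 s), pauli2_mul_self, one_mul, pauli2_mul_self]
  simp only [smul_mul_assoc, h1] at h'
  simpa using congrFun (congrFun h' 0) 0

lemma pauliStrings_eq : pauliStrings = pauli2 '' {s | s ≠ 0} := by
  ext A
  simp only [pauliStrings, ← range_pauli, Set.exists_range_iff, Set.mem_ofPred_eq, Set.mem_image]
  constructor
  · rintro ⟨⟨a, b, rfl⟩, h⟩
    refine ⟨(a, b), ?_, rfl⟩
    rintro h0
    apply h
    rw [Matrix.one_kronecker_one, ← pauli2_zero, ← h0]
    rfl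
  · rintro ⟨s, hs, rfl⟩
    refine ⟨⟨s.1, s.2, rfl⟩, fun h => hs ?_⟩
    rw [Matrix.one_kronecker_one, ← pauli2_zero] at h
    exact pauli2_injective h

/-- Pauli lines in terms of indices: the nonzero parts of the isotropic planes of `symp2`. -/
def isotropicLines : Finset (Finset Idx) :=
  (Finset.univ.filter fun p : Idx × Idx =>
    p.1 ≠ 0 ∧ p.2 ≠ 0 ∧ p.1 ≠ p.2 ∧ symp2 p.1 p.2 = 0).image fun p => {p.1, p.2, p.1 + p.2}

lemma exists_sign_iff {s t u : Idx} (hst : pauli2 s * pauli2 t = pauli2 t * pauli2 s)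
    (hsu : pauli2 s * pauli2 u = pauli2 u * pauli2 s)
    (htu : pauli2 t * pauli2 u = pauli2 u * pauli2 t) :
    (∃ ε : ℂ, (ε = 1 ∨ ε = -1) ∧ pauli2 s * pauli2 t * pauli2 u =
      ε • (1 : Matrix (Fin 2 × Fin 2) (Fin 2 × Fin 2) ℂ)) ↔ u = s + t := by
  obtain ⟨c, hc⟩ := exists_pauli2_mul s t
  obtain ⟨d, hd⟩ := exists_pauli2_mul (s + t) u
  have hcd : pauli2 s * pauli2 t * pauli2 u = (c * d) • pauli2 (s + t + u) := by
    rw [hc, smul_mul_assoc, hd, smul_smul]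
  constructor
  · rintro ⟨ε, hε, h⟩
    have h0 : ε ≠ 0 := by rcases hε with rfl | rfl <;> norm_num
    exact ((add_eq_zero_iff_eq _ _).1 (eq_zero_of_smul_pauli2_eq h0 (hcd.symm.trans h))).symm
  · rintro rfl
    rw [(add_eq_zero_iff_eq _ _).2 rfl, pauli2_zero] at hcd
    refine ⟨c * d, ?_, hcd⟩
    have hst' : Commute (pauli2 s) (pauli2 t) := hst
    have hsu' : Commute (pauli2 s) (pauli2 (s + t)) := hsu
    have htu' : Commute (pauli2 t) (pauli2 (s + t)) := htu
    have hsq : (pauli2 s * pauli2 t * pauli2 (s + t)) *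
        (pauli2 s * pauli2 t * pauli2 (s + t)) = 1 := by
      rw [(hsu'.mul_left htu').symm.mul_mul_mul_comm, hst'.symm.mul_mul_mul_comm,
        pauli2_mul_self, pauli2_mul_self, pauli2_mul_self, one_mul, one_mul]
    rw [hcd] at hsq
    have := congrFun (congrFun hsq 0) 0
    simp only [smul_mul_smul_comm, mul_one, Matrix.smul_apply, Matrix.one_apply_eq,
      smul_eq_mul] at this
    exact mul_self_eq_one_iff.1 this

lemma isPauliLine_iff (L : Set (Matrix (Fin 2 × Fin 2) (Fin 2 × Fin 2) ℂ)) :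
    IsPauliLine L ↔ ∃ S ∈ isotropicLines, pauli2 '' (S : Set Idx) = L := by
  simp only [isotropicLines, Finset.mem_image, Finset.mem_filter, Finset.mem_univ, true_and]
  constructor
  · rintro ⟨P, Q, R, hP, hQ, hR, hPQ, -, -, rfl, hPQ', hPR', hQR', hε⟩
    rw [pauliStrings_eq] at hP hQ hR
    obtain ⟨s, hs, rfl⟩ := hP
    obtain ⟨t, ht, rfl⟩ := hQ
    obtain ⟨u, -, rfl⟩ := hR
    obtain rfl := (exists_sign_iff hPQ' hPR' hQR').1 hε
    refine ⟨_, ⟨(s, t), ⟨hs, ht, fun h => hPQ (congrArg pauli2 h),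
      (pauli2_mul_comm_iff s t).1 hPQ'⟩, rfl⟩, ?_⟩
    simp [Set.image_insert_eq]
  · rintro ⟨_, ⟨⟨s, t⟩, ⟨hs, ht, hne, h⟩, rfl⟩, rfl⟩
    dsimp only at hs ht hne h
    have hadd : ∀ s t : Idx, symp2 s t = 0 → symp2 s (s + t) = 0 ∧ symp2 t (s + t) = 0 := by
      decide +kernel
    have hst := (pauli2_mul_comm_iff s t).2 h
    have hsu := (pauli2_mul_comm_iff s (s + t)).2 (hadd s t h).1
    have htu := (pauli2_mul_comm_iff t (s + t)).2 (hadd s t h).2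
    rw [IsPauliLine, pauliStrings_eq]
    refine ⟨pauli2 s, pauli2 t, pauli2 (s + t), ⟨s, hs, rfl⟩, ⟨t, ht, rfl⟩,
      ⟨s + t, fun h' => hne ((add_eq_zero_iff_eq s t).1 h'), rfl⟩, pauli2_injective.ne hne,
      pauli2_injective.ne (by simpa using ht), pauli2_injective.ne (by simpa using hs),
      by simp [Set.image_insert_eq], hst, hsu, htu, (exists_sign_iff hst hsu htu).2 rfl⟩

lemma image_pauli2_injective :
    Function.Injective fun S : Finset Idx => pauli2 '' (S : Set Idx) :=
  pauli2_injective.image_injective.comp Finset.coe_injective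

lemma card_isotropicLines : isotropicLines.card = 15 := by decide +kernel

lemma card_isotropicLines_filter_mem :
    ∀ s : Idx, s ≠ 0 → (isotropicLines.filter (s ∈ ·)).card = 3 := by decide +kernel

lemma ncard_isPauliLine : {L | IsPauliLine L}.ncard = 15 := by
  have h : {L | IsPauliLine L} =
      (fun S : Finset Idx => pauli2 '' (S : Set Idx)) '' (isotropicLines : Set (Finset Idx)) :=
    Set.ext isPauliLine_iff
  rw [h, Set.ncard_image_of_injective _ image_pauli2_injective, Set.ncard_coe_finset,
    card_isotropicLines]

lemma ncard_isPauliLine_mem {P : Matrix (Fin 2 × Fin 2) (Fin 2 × Fin 2) ℂ}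
    (hP : P ∈ pauliStrings) : {L | IsPauliLine L ∧ P ∈ L}.ncard = 3 := by
  rw [pauliStrings_eq] at hP
  obtain ⟨s, hs, rfl⟩ := hP
  have h : {L | IsPauliLine L ∧ pauli2 s ∈ L} =
      (fun S : Finset Idx => pauli2 '' (S : Set Idx)) ''
        (isotropicLines.filter (s ∈ ·) : Finset (Finset Idx)) := by
    ext L
    simp only [Set.mem_ofPred_eq, isPauliLine_iff, Set.mem_image, Finset.coe_filter]
    constructor
    · rintro ⟨⟨S, hS, rfl⟩, hmem⟩
      exact ⟨S, ⟨hS, by simpa using (pauli2_injective.mem_set_image).1 hmem⟩, rfl⟩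
    · rintro ⟨S, ⟨hS, hmem⟩, rfl⟩
      exact ⟨⟨S, hS, rfl⟩, Set.mem_image_of_mem _ hmem⟩
  rw [h, Set.ncard_image_of_injective _ image_pauli2_injective, Set.ncard_coe_finset,
    card_isotropicLines_filter_mem s hs]

/-- The indices of the line `{X⊗1, 1⊗X, X⊗X}`. -/
def lineX : Finset Idx := {((1, 0), (0, 0)), ((0, 0), (1, 0)), ((1, 0), (1, 0))}

/-- The indices of the line `{Y⊗1, 1⊗Y, Y⊗Y}`. -/
def lineY : Finset Idx := {((1, 1), (0, 0)), ((0, 0), (1, 1)), ((1, 1), (1, 1))}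

/-- The indices of the line `{Z⊗1, 1⊗Z, Z⊗Z}`. -/
def lineZ : Finset Idx := {((0, 1), (0, 0)), ((0, 0), (0, 1)), ((0, 1), (0, 1))}

/-- The indices of the line `{X⊗Y, Y⊗Z, Z⊗X}`. -/
def lineXYZ : Finset Idx := {((1, 0), (1, 1)), ((1, 1), (0, 1)), ((0, 1), (1, 0))}

/-- The indices of the line `{Y⊗X, Z⊗Y, X⊗Z}`. -/
def lineYXZ : Finset Idx := {((1, 1), (1, 0)), ((0, 1), (1, 1)), ((1, 0), (0, 1))}

lemma image_lineX : pauli2 '' (lineX : Set Idx) =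
    {σx ⊗ₖ 1, (1 : Matrix (Fin 2) (Fin 2) ℂ) ⊗ₖ σx, σx ⊗ₖ σx} := by
  simp [lineX, Set.image_insert_eq, pauli2, pauli]

lemma image_lineY : pauli2 '' (lineY : Set Idx) =
    {σy ⊗ₖ 1, (1 : Matrix (Fin 2) (Fin 2) ℂ) ⊗ₖ σy, σy ⊗ₖ σy} := by
  simp [lineY, Set.image_insert_eq, pauli2, pauli]

lemma image_lineZ : pauli2 '' (lineZ : Set Idx) =
    {σz ⊗ₖ 1, (1 : Matrix (Fin 2) (Fin 2) ℂ) ⊗ₖ σz, σz ⊗ₖ σz} := by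
  simp [lineZ, Set.image_insert_eq, pauli2, pauli]

lemma image_lineXYZ : pauli2 '' (lineXYZ : Set Idx) = {σx ⊗ₖ σy, σy ⊗ₖ σz, σz ⊗ₖ σx} := by
  simp [lineXYZ, Set.image_insert_eq, pauli2, pauli]

lemma image_lineYXZ : pauli2 '' (lineYXZ : Set Idx) = {σy ⊗ₖ σx, σz ⊗ₖ σy, σx ⊗ₖ σz} := by
  simp [lineYXZ, Set.image_insert_eq, pauli2, pauli]

/-- (i) There are exactly 15 Pauli lines; (ii) every two-qubit Pauli string lies on
exactly 3 Pauli lines; (iii) the five indicated lines are pairwise disjoint Pauli lines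
whose union is all of `𝒫`. -/
theorem stmt_13 :
    {L | IsPauliLine L}.ncard = 15 ∧
    (∀ P ∈ pauliStrings, {L | IsPauliLine L ∧ P ∈ L}.ncard = 3) ∧
    (IsPauliLine {σx ⊗ₖ 1, (1 : Matrix (Fin 2) (Fin 2) ℂ) ⊗ₖ σx, σx ⊗ₖ σx} ∧
     IsPauliLine {σy ⊗ₖ 1, (1 : Matrix (Fin 2) (Fin 2) ℂ) ⊗ₖ σy, σy ⊗ₖ σy} ∧
     IsPauliLine {σz ⊗ₖ 1, (1 : Matrix (Fin 2) (Fin 2) ℂ) ⊗ₖ σz, σz ⊗ₖ σz} ∧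
     IsPauliLine {σx ⊗ₖ σy, σy ⊗ₖ σz, σz ⊗ₖ σx} ∧
     IsPauliLine {σy ⊗ₖ σx, σz ⊗ₖ σy, σx ⊗ₖ σz}) ∧
    List.Pairwise Disjoint
      [({σx ⊗ₖ 1, (1 : Matrix (Fin 2) (Fin 2) ℂ) ⊗ₖ σx, σx ⊗ₖ σx} :
          Set (Matrix (Fin 2 × Fin 2) (Fin 2 × Fin 2) ℂ)),
        {σy ⊗ₖ 1, (1 : Matrix (Fin 2) (Fin 2) ℂ) ⊗ₖ σy, σy ⊗ₖ σy},
        {σz ⊗ₖ 1, (1 : Matrix (Fin 2) (Fin 2) ℂ) ⊗ₖ σz, σz ⊗ₖ σz},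
        {σx ⊗ₖ σy, σy ⊗ₖ σz, σz ⊗ₖ σx},
        {σy ⊗ₖ σx, σz ⊗ₖ σy, σx ⊗ₖ σz}] ∧
    ({σx ⊗ₖ 1, (1 : Matrix (Fin 2) (Fin 2) ℂ) ⊗ₖ σx, σx ⊗ₖ σx} :
        Set (Matrix (Fin 2 × Fin 2) (Fin 2 × Fin 2) ℂ)) ∪
      {σy ⊗ₖ 1, (1 : Matrix (Fin 2) (Fin 2) ℂ) ⊗ₖ σy, σy ⊗ₖ σy} ∪
      {σz ⊗ₖ 1, (1 : Matrix (Fin 2) (Fin 2) ℂ) ⊗ₖ σz, σz ⊗ₖ σz} ∪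
      {σx ⊗ₖ σy, σy ⊗ₖ σz, σz ⊗ₖ σx} ∪
      {σy ⊗ₖ σx, σz ⊗ₖ σy, σx ⊗ₖ σz} = pauliStrings := by
  rw [← image_lineX, ← image_lineY, ← image_lineZ, ← image_lineXYZ, ← image_lineYXZ]
  refine ⟨ncard_isPauliLine, fun P hP => ncard_isPauliLine_mem hP, ?_, ?_, ?_⟩
  · simp only [isPauliLine_iff]
    exact ⟨⟨lineX, by decide +kernel, rfl⟩, ⟨lineY, by decide +kernel, rfl⟩,
      ⟨lineZ, by decide +kernel, rfl⟩, ⟨lineXYZ, by decide +kernel, rfl⟩,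
      ⟨lineYXZ, by decide +kernel, rfl⟩⟩
  · have h : List.Pairwise Disjoint [lineX, lineY, lineZ, lineXYZ, lineYXZ] := by decide +kernel
    refine h.map (fun S : Finset Idx => pauli2 '' (S : Set Idx)) fun S T hST => ?_
    exact (Set.disjoint_image_iff pauli2_injective).2 (Finset.disjoint_coe.2 hST)
  · have h : ∀ s, s ∈ lineX ∪ lineY ∪ lineZ ∪ lineXYZ ∪ lineYXZ ↔ s ≠ 0 := by decide +kernel
    simp only [pauliStrings_eq, ← Set.image_union, ← Finset.coe_union]
    exact congrArg _ (Set.ext h)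

end Stmt13
end
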